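/- Let d ≥ 1 and let 1 ≤ p < ∞. For any four nested Borel sets F ⊆ G ⊆ F' ⊆ G' in ℝ^d, the p-capacities satisfy CAP_p(F' \ G, G' \ F)^(1/p) ≤ CAP_p(F, G)^(1/p) + CAP_p(F', G')^(1/p). -/

import Mathlib

open Metric MeasureTheory ENNReal NNReal

/-- The `p`-capacity of a capacitor `(F, G)` in `ℝ^d`: the infimum of `∫ ‖∇u‖^p` over
Lipschitz test functions `u` equal to `1` on a neighbourhood of `F`, with compact
support contained in the interior of `G`.  (The derivative of a Lipschitz function
exists a.e. by Rademacher's theorem, and `fderiv` agrees with it a.e.)  The infimum of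
the empty set is `+∞`. -/
noncomputable def pCap (d : ℕ) (p : ℝ) (F G : Set (EuclideanSpace ℝ (Fin d))) : ℝ≥0∞ :=
  sInf { E : ℝ≥0∞ | ∃ u : EuclideanSpace ℝ (Fin d) → ℝ,
    (∃ K : ℝ≥0, LipschitzWith K u) ∧
    (∃ U : Set (EuclideanSpace ℝ (Fin d)), IsOpen U ∧ F ⊆ U ∧ ∀ x ∈ U, u x = 1) ∧
    HasCompactSupport u ∧ tsupport u ⊆ interior G ∧
    E = ∫⁻ x, ENNReal.ofReal (‖fderiv ℝ u x‖ ^ p) ∂volume }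

open Filter Topology in
theorem enorm_fderiv_max_zero_le {E : Type*} [NormedAddCommGroup E] [NormedSpace ℝ E]
    {w : E → ℝ} {x : E} (hw : ContinuousAt w x) :
    ‖fderiv ℝ (fun y => max (w y) 0) x‖ₑ ≤ ‖fderiv ℝ w x‖ₑ := by
  rcases le_or_gt (w x) 0 with h | h
  · have hmin : IsLocalMin (fun y => max (w y) 0) x :=
      Eventually.of_forall fun y => by simp [max_eq_right h]
    rw [hmin.fderiv_eq_zero, ← ofReal_norm, norm_zero, ENNReal.ofReal_zero]
    exact zero_le
  · have heq : (fun y => max (w y) 0) =ᶠ[𝓝 x] w := by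
      filter_upwards [hw.eventually (lt_mem_nhds h)] with y hy
      exact max_eq_left hy.le
    rw [heq.fderiv_eq]

theorem LipschitzWith.lintegral_enorm_fderiv_max_rpow_le {E : Type*} [NormedAddCommGroup E]
    [NormedSpace ℝ E] [FiniteDimensional ℝ E] [MeasurableSpace E] [BorelSpace E]
    {μ : Measure E} [μ.IsAddHaarMeasure] {u v : E → ℝ} {K L : ℝ≥0}
    (hu : LipschitzWith K u) (hv : LipschitzWith L v) {p : ℝ} (hp : 1 ≤ p) (a b : ℝ) :
    (∫⁻ x, ‖fderiv ℝ (fun y => max (a * (v y - u y) - b) 0) x‖ₑ ^ p ∂μ) ^ (1 / p) ≤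
      ‖a‖ₑ * ((∫⁻ x, ‖fderiv ℝ u x‖ₑ ^ p ∂μ) ^ (1 / p) +
        (∫⁻ x, ‖fderiv ℝ v x‖ₑ ^ p ∂μ) ^ (1 / p)) := by
  have hp0 : 0 < p := by linarith
  calc (∫⁻ x, ‖fderiv ℝ (fun y => max (a * (v y - u y) - b) 0) x‖ₑ ^ p ∂μ) ^ (1 / p)
      ≤ (∫⁻ x, ‖a‖ₑ ^ p * (‖fderiv ℝ u x‖ₑ + ‖fderiv ℝ v x‖ₑ) ^ p ∂μ) ^ (1 / p) := by
        refine ENNReal.rpow_le_rpow (lintegral_mono_ae ?_) (by positivity)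
        filter_upwards [hu.ae_differentiableAt, hv.ae_differentiableAt] with x hux hvx
        rw [← ENNReal.mul_rpow_of_nonneg _ _ hp0.le]
        refine ENNReal.rpow_le_rpow ?_ hp0.le
        have hd : HasFDerivAt (fun y => a * (v y - u y) - b)
            (a • (fderiv ℝ v x - fderiv ℝ u x)) x :=
          ((hvx.hasFDerivAt.sub hux.hasFDerivAt).const_mul a).sub_const b
        refine (enorm_fderiv_max_zero_le hd.continuousAt).trans ?_
        rw [hd.fderiv, enorm_smul, add_comm]
        gcongr
        exact enorm_sub_le
    _ = ‖a‖ₑ * (∫⁻ x, (‖fderiv ℝ u x‖ₑ + ‖fderiv ℝ v x‖ₑ) ^ p ∂μ) ^ (1 / p) := by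
        rw [lintegral_const_mul' _ _ (by finiteness),
          ENNReal.mul_rpow_of_nonneg _ _ (by positivity), ← ENNReal.rpow_mul,
          mul_one_div_cancel hp0.ne', ENNReal.rpow_one]
    _ ≤ _ := by
        gcongr
        exact ENNReal.lintegral_Lp_add_le (measurable_fderiv ℝ u).enorm.aemeasurable
          (measurable_fderiv ℝ v).enorm.aemeasurable hp

theorem ofReal_norm_rpow {E : Type*} [SeminormedAddCommGroup E] (x : E) {p : ℝ} (hp : 0 ≤ p) :
    ENNReal.ofReal (‖x‖ ^ p) = ‖x‖ₑ ^ p := by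
  rw [← ENNReal.ofReal_rpow_of_nonneg (norm_nonneg x) hp, ofReal_norm]

open Filter Topology in
theorem ENNReal.le_of_forall_one_lt_le_ofReal_mul {x y : ℝ≥0∞}
    (h : ∀ a : ℝ, 1 < a → x ≤ ENNReal.ofReal a * y) : x ≤ y := by
  have hlim : Tendsto (fun a : ℝ => ENNReal.ofReal a * y) (𝓝[>] 1) (𝓝 (ENNReal.ofReal 1 * y)) :=
    ENNReal.Tendsto.mul_const
      ((ENNReal.continuous_ofReal.tendsto 1).mono_left nhdsWithin_le_nhds) (by simp)
  rw [ENNReal.ofReal_one, one_mul] at hlim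
  exact ge_of_tendsto hlim (eventually_mem_nhdsWithin.mono h)

theorem tsupport_max_zero_subset {X : Type*} [TopologicalSpace X] {w : X → ℝ}
    (hw : Continuous w) : tsupport (fun y => max (w y) 0) ⊆ {x | 0 ≤ w x} := by
  refine closure_minimal (fun x hx => ?_) (isClosed_le continuous_const hw)
  by_contra h
  exact hx (max_eq_right (not_le.mp h).le)

/-- The truncation `max (a * (v - u) - (a - 1)) 0` is used instead of `v - u` because `v - u` may
fail to vanish near the boundary of `F`. -/
theorem pCap_diff_rpow_le_mul {d : ℕ} {p : ℝ} (hp : 1 ≤ p)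
    {F G F' G' : Set (EuclideanSpace ℝ (Fin d))} (hFF' : F ⊆ F') (hGG' : G ⊆ G')
    {u v : EuclideanSpace ℝ (Fin d) → ℝ} {K L : ℝ≥0}
    (hu : LipschitzWith K u) (hv : LipschitzWith L v) (huF : ∀ x ∈ F, u x = 1)
    {V : Set (EuclideanSpace ℝ (Fin d))} (hV : IsOpen V) (hF'V : F' ⊆ V) (hvV : ∀ x ∈ V, v x = 1)
    (huc : HasCompactSupport u) (hvc : HasCompactSupport v)
    (huG : tsupport u ⊆ interior G) (hvG : tsupport v ⊆ interior G') {a : ℝ} (ha : 1 < a) :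
    pCap d p (F' \ G) (G' \ F) ^ (1 / p) ≤ ENNReal.ofReal a *
      ((∫⁻ x, ENNReal.ofReal (‖fderiv ℝ u x‖ ^ p)) ^ (1 / p) +
        (∫⁻ x, ENNReal.ofReal (‖fderiv ℝ v x‖ ^ p)) ^ (1 / p)) := by
  have hp0 : 0 ≤ p := by linarith
  simp only [ofReal_norm_rpow _ hp0]
  rw [← Real.enorm_eq_ofReal (by linarith : 0 ≤ a)]
  refine le_trans ?_ (hu.lintegral_enorm_fderiv_max_rpow_le hv hp a (a - 1))
  refine ENNReal.rpow_le_rpow ?_ (by positivity)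
  have hcont : Continuous fun y => a * (v y - u y) - (a - 1) := by
    have := hu.continuous
    have := hv.continuous
    fun_prop
  have hsupp : tsupport (fun y => max (a * (v y - u y) - (a - 1)) 0) ⊆ tsupport u ∪ tsupport v := by
    intro x hx
    by_contra hxuv
    rw [Set.mem_union, not_or] at hxuv
    have h0 : 0 ≤ a * (v x - u x) - (a - 1) := tsupport_max_zero_subset hcont hx
    rw [image_eq_zero_of_notMem_tsupport hxuv.1, image_eq_zero_of_notMem_tsupport hxuv.2] at h0
    linarith
  have hF0 : closure F ⊆ {x | v x - u x = 0} := by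
    refine closure_minimal (fun x hx => ?_)
      (isClosed_eq (hv.continuous.sub hu.continuous) continuous_const)
    simp [huF x hx, hvV x (hF'V (hFF' hx))]
  refine sInf_le ⟨fun y => max (a * (v y - u y) - (a - 1)) 0, ⟨‖a‖₊ * (L + K), ?_⟩,
    ⟨V \ tsupport u, hV.sdiff (isClosed_tsupport u), ?_, ?_⟩, ?_, ?_, ?_⟩
  · refine LipschitzWith.max_const (LipschitzWith.of_dist_le_mul fun x y => ?_) 0
    have h := (hv.sub hu).dist_le_mul x y
    simp only [Real.dist_eq] at h ⊢
    rw [sub_sub_sub_cancel_right, ← mul_sub, abs_mul]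
    push_cast
    rw [mul_assoc]
    exact mul_le_mul_of_nonneg_left h (abs_nonneg a)
  · exact fun x hx => ⟨hF'V hx.1, fun hxu => hx.2 (interior_subset (huG hxu))⟩
  · intro x hx
    simp [hvV x hx.1, image_eq_zero_of_notMem_tsupport hx.2]
  · exact (huc.isCompact.union hvc.isCompact).of_isClosed_subset (isClosed_tsupport _) hsupp
  · intro x hx
    rw [Set.sdiff_eq, interior_inter, interior_compl]
    refine ⟨?_, fun hxF => ?_⟩
    · rcases hsupp hx with h | h
      · exact interior_mono hGG' (huG h)
      · exact hvG h
    · have h0 : 0 ≤ a * (v x - u x) - (a - 1) := tsupport_max_zero_subset hcont hx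
      have h1 : v x - u x = 0 := hF0 hxF
      rw [h1] at h0
      linarith
  · simp only [ofReal_norm_rpow _ hp0]

theorem ENNReal.sInf_rpow {s : Set ℝ≥0∞} {r : ℝ} (hr : 0 < r) :
    sInf s ^ r = ⨅ x ∈ s, x ^ r :=
  (ENNReal.orderIsoRpow r hr).map_sInf s

/-- for nested Borel sets `F ⊆ G ⊆ F' ⊆ G'` in `ℝ^d`,
`CAP_p(F' \ G, G' \ F)^(1/p) ≤ CAP_p(F, G)^(1/p) + CAP_p(F', G')^(1/p)`. -/
theorem pCap_diff_le (d : ℕ) (hd : 1 ≤ d) (p : ℝ) (hp : 1 ≤ p)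
    (F G F' G' : Set (EuclideanSpace ℝ (Fin d)))
    (hF : MeasurableSet F) (hG : MeasurableSet G)
    (hF' : MeasurableSet F') (hG' : MeasurableSet G')
    (hFG : F ⊆ G) (hGF' : G ⊆ F') (hF'G' : F' ⊆ G') :
    pCap d p (F' \ G) (G' \ F) ^ (1 / p) ≤
      pCap d p F G ^ (1 / p) + pCap d p F' G' ^ (1 / p) := by
  have hr : 0 < 1 / p := by positivity
  conv_rhs => rw [pCap, pCap, ENNReal.sInf_rpow hr, ENNReal.sInf_rpow hr]
  refine ENNReal.le_iInf₂_add_iInf₂ ?_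
  rintro _ ⟨u, ⟨K, hu⟩, ⟨U, -, hFU, huU⟩, huc, huG, rfl⟩
    _ ⟨v, ⟨L, hv⟩, ⟨V, hV, hF'V, hvV⟩, hvc, hvG, rfl⟩
  exact ENNReal.le_of_forall_one_lt_le_ofReal_mul fun a ha =>
    pCap_diff_rpow_le_mul hp (hFG.trans hGF') (hGF'.trans hF'G') hu hv
      (fun x hx => huU x (hFU hx)) hV hF'V hvV huc hvc huG hvG ha
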